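/- Let E ⊂ ℝ^d be non-empty and bounded, and define f : ℝ → ℝ by f(x) = s_E(exp(−exp(x))). Then there exists g ∈ 𝒢(0, dim_qA E), and in particular g ∈ 𝒢(0,d), such that f is asymptotically equivalent to g. -/

import Mathlib

open Set Metric Filter Topology MeasureTheory

noncomputable section

/-- Least number of open balls of radius `r` needed to cover `E`. -/
def coveringNumber {α : Type*} [PseudoMetricSpace α] (E : Set α) (r : ℝ) : ℕ :=
  sInf {n : ℕ | ∃ t : Finset α, t.card = n ∧ E ⊆ ⋃ x ∈ t, Metric.ball x r}

/-- `s_E(r) = log N_r(E) / log (1/r)`. -/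
def sFun {α : Type*} [PseudoMetricSpace α] (E : Set α) (r : ℝ) : ℝ :=
  Real.log (coveringNumber E r) / Real.log (1 / r)

/-- Lower box dimension. -/
def dimLB {α : Type*} [PseudoMetricSpace α] (E : Set α) : ℝ :=
  Filter.liminf (fun r => sFun E r) (nhdsWithin (0 : ℝ) (Set.Ioi 0))

/-- Upper box dimension. -/
def dimUB {α : Type*} [PseudoMetricSpace α] (E : Set α) : ℝ :=
  Filter.limsup (fun r => sFun E r) (nhdsWithin (0 : ℝ) (Set.Ioi 0))

/-- Upper right Dini derivative. -/
def upperDini (g : ℝ → ℝ) (x : ℝ) : ℝ :=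
  Filter.limsup (fun h => (g (x + h) - g x) / h) (nhdsWithin (0 : ℝ) (Set.Ioi 0))

/-- The class `𝒢(λ, α)`. -/
def GClass (lam alp : ℝ) : Set (ℝ → ℝ) :=
  {g | Continuous g ∧ (∀ x, g x ∈ Set.Icc lam alp) ∧
    ∀ x, upperDini g x ∈ Set.Icc (lam - g x) (alp - g x)}

/-- Asymptotic equivalence of two functions. -/
def AsympEquiv (f g : ℝ → ℝ) : Prop :=
  Filter.Tendsto (fun x => f x - g x) Filter.atTop (nhds 0)

/-- `E` has covering class `g`. -/
def HasCoveringClass {α : Type*} [PseudoMetricSpace α] (E : Set α) (g : ℝ → ℝ) : Prop :=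
  AsympEquiv (fun x => sFun E (Real.exp (-Real.exp x))) g

/-- Composition of the maps indexed by a finite word. -/
def compMaps {α : Type*} {I : Type*} (T : I → α → α) : List I → α → α
  | [] => id
  | i :: w => T i ∘ compMaps T w

/-- A conformal iterated function system on `ℝ^d` satisfying the open set condition
and the cone condition. -/
structure CIFS (d : ℕ) where
  /-- the compact seed set -/
  X : Set (EuclideanSpace ℝ (Fin d))
  /-- the countable index set -/
  I : Type
  /-- the contractions -/
  S : I → EuclideanSpace ℝ (Fin d) → EuclideanSpace ℝ (Fin d)
  hXcompact : IsCompact X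
  hXconn : IsConnected X
  hXint : (interior X).Nonempty
  hIcount : Countable I
  hInonempty : Nonempty I
  hSmaps : ∀ i, Set.MapsTo (S i) X X
  /-- the uniform contraction ratio -/
  c : ℝ
  hc0 : 0 < c
  hc1 : c < 1
  hcontr : ∀ i, ∀ x ∈ X, ∀ y ∈ X,
    (x ≠ y → 0 < dist (S i x) (S i y)) ∧ dist (S i x) (S i y) ≤ c * dist x y
  /-- the open connected set on which the maps extend conformally -/
  V : Set (EuclideanSpace ℝ (Fin d))
  hVopen : IsOpen V
  hVbdd : Bornology.IsBounded V
  hVconn : IsConnected V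
  hXV : X ⊆ V
  /-- the conformal extensions -/
  T : I → EuclideanSpace ℝ (Fin d) → EuclideanSpace ℝ (Fin d)
  hTagree : ∀ i, ∀ x ∈ X, T i x = S i x
  hTmaps : ∀ i, Set.MapsTo (T i) V V
  hTinj : ∀ i, Set.InjOn (T i) V
  /-- the Hölder exponent in `C^{1+ε}` -/
  eps : ℝ
  heps : 0 < eps
  hTdiff : ∀ i, ContDiffOn ℝ 1 (T i) V
  hTholder : ∀ i, ∃ C : ℝ, 0 < C ∧ ∀ x ∈ V, ∀ y ∈ V,
    ‖fderiv ℝ (T i) x - fderiv ℝ (T i) y‖ ≤ C * ‖x - y‖ ^ eps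
  hTconf : ∀ i, ∀ x ∈ V, IsConformalMap (fderiv ℝ (T i) x)
  /-- the bounded distortion constant -/
  K : ℝ
  hK : 1 ≤ K
  hBD : ∀ w : List I, ∀ x ∈ V, ∀ y ∈ V,
    ‖fderiv ℝ (compMaps T w) x‖ ≤ K * ‖fderiv ℝ (compMaps T w) y‖
  hOSCin : ∀ i, S i '' interior X ⊆ interior X
  hOSCdisj : ∀ i j, i ≠ j → Disjoint (S i '' interior X) (S j '' interior X)
  hCone : ∃ κ : ℝ, 0 < κ ∧ ∀ x ∈ X, ∀ r : ℝ, 0 < r → r < 1 →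
    ENNReal.ofReal (κ * r ^ d) ≤ volume (Metric.ball x r ∩ interior X)

/-- The limit set (attractor) of a CIFS. -/
def CIFS.limitSet {d : ℕ} (Φ : CIFS d) : Set (EuclideanSpace ℝ (Fin d)) :=
  ⋃ γ : ℕ → Φ.I, ⋂ n : ℕ, compMaps Φ.S (List.ofFn fun k : Fin (n + 1) => γ k) '' Φ.X

/-- The set of fixed points of the maps of a CIFS. -/
def CIFS.fixedPoints {d : ℕ} (Φ : CIFS d) : Set (EuclideanSpace ℝ (Fin d)) :=
  {x | x ∈ Φ.X ∧ ∃ i, Φ.S i x = x}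

/-- `ρ(w) = sup_{x ∈ X} ‖S'_w(x)‖`. -/
def CIFS.rho {d : ℕ} (Φ : CIFS d) (w : List Φ.I) : ℝ :=
  sSup ((fun x => ‖fderiv ℝ (compMaps Φ.T w) x‖) '' Φ.X)

/-- `Ψ(r, θ) = (1 - θ)·dim_H Λ + θ·s_F(r^θ)`. -/
def CIFS.Psi {d : ℕ} (Φ : CIFS d) (r θ : ℝ) : ℝ :=
  (1 - θ) * (dimH Φ.limitSet).toReal + θ * sFun Φ.fixedPoints (r ^ θ)

/-- `ψ(r) = max_{θ ∈ [0,1]} Ψ(r,θ)` (which equals the supremum over `θ ∈ (0,1]`,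
since `Ψ(r,0)` is defined as the limit of `Ψ(r,θ)` as `θ → 0⁺`). -/
def CIFS.psi {d : ℕ} (Φ : CIFS d) (r : ℝ) : ℝ :=
  sSup (Φ.Psi r '' Set.Ioc (0 : ℝ) 1)

/-- The interval `𝒟(h, s, t, α)`. -/
def Dset (h s t α : ℝ) : Set ℝ :=
  if t ≤ h then {h}
  else Set.Icc (max h s) (h + (t - h) * (α - h) * s / (α * t - h * s))

/-- The quantity whose limit as `θ → 1⁻` is the quasi-Assouad dimension. -/
def quasiAssouadAux {α : Type*} [PseudoMetricSpace α] (E : Set α) (θ : ℝ) : ℝ :=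
  sInf {t : ℝ | 0 ≤ t ∧ ∃ C : ℝ, 0 < C ∧ ∀ x ∈ E, ∀ r R : ℝ,
    0 < r → r ≤ R ^ (1 / θ) → R ^ (1 / θ) ≤ R → R < 1 →
    (coveringNumber (E ∩ Metric.ball x R) r : ℝ) ≤ C * (R / r) ^ t}

/-- The quasi-Assouad dimension. -/
def dimqA {α : Type*} [PseudoMetricSpace α] (E : Set α) : ℝ :=
  Filter.limsup (quasiAssouadAux E) (nhdsWithin (1 : ℝ) (Set.Iio 1))

/-- The modified lower box dimension. -/
def dimLMB {α : Type*} [PseudoMetricSpace α] (K : Set α) : ℝ :=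
  sInf {s : ℝ | ∃ C : ℕ → Set α, (K ⊆ ⋃ i, C i) ∧
    (∀ i, (C i).Nonempty ∧ Bornology.IsBounded (C i)) ∧ s = ⨆ i, dimLB (C i)}

/-- The unit cube `[0,1]^d`. -/
def unitCube (d : ℕ) : Set (EuclideanSpace ℝ (Fin d)) :=
  {x | ∀ j, x j ∈ Set.Icc (0 : ℝ) 1}

/-- The basic similarity maps in the homogeneous Moran construction. -/
def moranMap (d : ℕ) (r : ℝ) (i : Fin d → Bool)
    (x : EuclideanSpace ℝ (Fin d)) : EuclideanSpace ℝ (Fin d) :=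
  (EuclideanSpace.equiv (Fin d) ℝ).symm (fun j => r * x j + (if i j then 1 - r else 0))

/-- The `n`-th level of the homogeneous Moran construction. -/
def moranLevel (d : ℕ) : (ℕ → ℝ) → ℕ → Set (EuclideanSpace ℝ (Fin d))
  | _, 0 => unitCube d
  | r, n + 1 => ⋃ i : Fin d → Bool, moranMap d (r 1) i '' moranLevel d (fun k => r (k + 1)) n

/-- The homogeneous Moran set `M(r)`. -/
def moranSet (d : ℕ) (r : ℕ → ℝ) : Set (EuclideanSpace ℝ (Fin d)) :=
  ⋂ n, moranLevel d r (n + 1)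

/-- The Gauss map `x ↦ 1/x - ⌊1/x⌋`. -/
def gaussMap (x : ℝ) : ℝ := Int.fract (1 / x)

/-- The `n`-th partial quotient (continued fraction digit) of `x` (`n = 0` gives `b₁ = ⌊1/x⌋`). -/
def cfDigit (x : ℝ) (n : ℕ) : ℤ := ⌊1 / gaussMap^[n] x⌋

/-- The set of irrationals in `(0,1)` all of whose continued fraction digits lie in `I`. -/
def cfSet (I : Set ℕ) : Set ℝ :=
  {x | x ∈ Set.Ioo (0 : ℝ) 1 ∧ Irrational x ∧ ∀ n : ℕ, ∃ b ∈ I, cfDigit x n = (b : ℤ)}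

section CoveringNumbers

variable {α : Type*} [PseudoMetricSpace α]

theorem coveringNumber_le_card {E : Set α} {r : ℝ} (t : Finset α)
    (h : E ⊆ ⋃ x ∈ t, Metric.ball x r) : coveringNumber E r ≤ t.card :=
  Nat.sInf_le ⟨t, rfl, h⟩

theorem exists_card_eq_coveringNumber {E : Set α} {r : ℝ}
    (h : ∃ t : Finset α, E ⊆ ⋃ x ∈ t, Metric.ball x r) :
    ∃ t : Finset α, t.card = coveringNumber E r ∧ E ⊆ ⋃ x ∈ t, Metric.ball x r := by
  obtain ⟨t, ht⟩ := h
  exact Nat.sInf_mem (s := {n : ℕ | ∃ t : Finset α, t.card = n ∧ E ⊆ ⋃ x ∈ t, Metric.ball x r})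
    ⟨t.card, t, rfl, ht⟩

theorem coveringNumber_pos {E : Set α} {r : ℝ} (hE : E.Nonempty)
    (h : ∃ t : Finset α, E ⊆ ⋃ x ∈ t, Metric.ball x r) : 0 < coveringNumber E r := by
  obtain ⟨t, htc, ht⟩ := exists_card_eq_coveringNumber h
  rw [← htc, Finset.card_pos]
  obtain ⟨x, hx⟩ := hE
  have hx' := ht hx
  simp only [Set.mem_iUnion] at hx'
  obtain ⟨y, hy, -⟩ := hx'
  exact ⟨y, hy⟩

theorem coveringNumber_anti {E : Set α} {r s : ℝ} (hrs : r ≤ s)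
    (h : ∃ t : Finset α, E ⊆ ⋃ x ∈ t, Metric.ball x r) :
    coveringNumber E s ≤ coveringNumber E r := by
  obtain ⟨t, htc, ht⟩ := exists_card_eq_coveringNumber h
  rw [← htc]
  exact coveringNumber_le_card t
    (ht.trans (Set.iUnion₂_mono fun x _ => Metric.ball_subset_ball hrs))

/-- A uniform bound on the local covering numbers at scale `2 * R` bounds the growth of the
global covering number between the scales `R` and `r`. -/
theorem coveringNumber_le_mul {E : Set α} {r R B : ℝ} (hB : 0 ≤ B)
    (hr : ∃ t : Finset α, E ⊆ ⋃ x ∈ t, Metric.ball x r)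
    (hR : ∃ t : Finset α, E ⊆ ⋃ x ∈ t, Metric.ball x R)
    (hloc : ∀ x ∈ E, (coveringNumber (E ∩ Metric.ball x (2 * R)) r : ℝ) ≤ B) :
    (coveringNumber E r : ℝ) ≤ coveringNumber E R * B := by
  classical
  obtain ⟨t, htc, ht⟩ := exists_card_eq_coveringNumber hR
  have key : ∀ y : α, ∃ u : Finset α, (u.card : ℝ) ≤ B ∧
      E ∩ Metric.ball y R ⊆ ⋃ x ∈ u, Metric.ball x r := by
    intro y
    rcases (E ∩ Metric.ball y R).eq_empty_or_nonempty with h | ⟨x, hxE, hxy⟩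
    · exact ⟨∅, by simpa using hB, by simp [h]⟩
    · obtain ⟨w, hw⟩ := hr
      obtain ⟨u, huc, hu⟩ := exists_card_eq_coveringNumber
        (E := E ∩ Metric.ball x (2 * R)) ⟨w, Set.inter_subset_left.trans hw⟩
      refine ⟨u, by rw [huc]; exact hloc x hxE, Set.Subset.trans ?_ hu⟩
      rintro z ⟨hzE, hzy⟩
      refine ⟨hzE, ?_⟩
      rw [Metric.mem_ball] at *
      linarith [dist_triangle_right z x y]
  choose u huc hu using key
  have hcover : E ⊆ ⋃ x ∈ t.biUnion u, Metric.ball x r := by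
    intro z hz
    have hz' := ht hz
    simp only [Set.mem_iUnion] at hz'
    obtain ⟨y, hy, hzy⟩ := hz'
    have hz'' := hu y ⟨hz, hzy⟩
    simp only [Set.mem_iUnion] at hz''
    obtain ⟨x, hx, hzx⟩ := hz''
    simp only [Set.mem_iUnion]
    exact ⟨x, Finset.mem_biUnion.2 ⟨y, hy, hx⟩, hzx⟩
  calc (coveringNumber E r : ℝ) ≤ (t.biUnion u).card := by
        exact_mod_cast coveringNumber_le_card _ hcover
    _ ≤ ∑ y ∈ t, ((u y).card : ℝ) := by exact_mod_cast Finset.card_biUnion_le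
    _ ≤ ∑ _y ∈ t, B := Finset.sum_le_sum fun y _ => huc y
    _ = coveringNumber E R * B := by rw [Finset.sum_const, nsmul_eq_mul, htc]

/-- If `r`-separated finite subsets of `S` have bounded cardinality, then so do optimal covers. -/
theorem coveringNumber_le_of_separated {S : Set α} {r : ℝ} (hr : 0 < r) {M : ℕ}
    (h : ∀ t : Finset α, (t : Set α) ⊆ S →
      (∀ x ∈ t, ∀ y ∈ t, x ≠ y → r ≤ dist x y) → t.card ≤ M) :
    coveringNumber S r ≤ M := by
  classical
  let A : Set ℕ := {n | ∃ t : Finset α, (t : Set α) ⊆ S ∧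
    (∀ x ∈ t, ∀ y ∈ t, x ≠ y → r ≤ dist x y) ∧ t.card = n}
  have hA : BddAbove A := ⟨M, by rintro _ ⟨t, h1, h2, rfl⟩; exact h t h1 h2⟩
  have hne : A.Nonempty := ⟨0, ∅, by simp⟩
  obtain ⟨t, htS, hsep, hcard⟩ := Nat.sSup_mem hne hA
  refine (coveringNumber_le_card t fun z hz => ?_).trans (h t htS hsep)
  by_contra hcon
  simp only [Set.mem_iUnion, Metric.mem_ball, not_exists, not_lt] at hcon
  have hzt : z ∉ t := fun hzt => by
    have := hcon z hzt
    rw [dist_self] at this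
    linarith
  have hmem : (insert z t).card ∈ A := by
    refine ⟨insert z t, ?_, ?_, rfl⟩
    · rw [Finset.coe_insert]
      exact Set.insert_subset hz htS
    · intro x hx y hy hxy
      rcases Finset.mem_insert.1 hx with hxz | hx <;>
        rcases Finset.mem_insert.1 hy with hyz | hy
      · exact absurd (hxz.trans hyz.symm) hxy
      · exact hxz ▸ hcon y hy
      · rw [hyz, dist_comm]
        exact hcon x hx
      · exact hsep x hx y hy hxy
  have := le_csSup hA hmem
  rw [Finset.card_insert_of_notMem hzt, hcard] at this
  omega

theorem exists_finset_cover_of_isBounded [ProperSpace α] {E : Set α}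
    (hE : Bornology.IsBounded E) {r : ℝ} (hr : 0 < r) :
    ∃ t : Finset α, E ⊆ ⋃ x ∈ t, Metric.ball x r := by
  obtain ⟨t, ht, hEt⟩ := Metric.totallyBounded_iff.1 (hE.isCompact_closure.totallyBounded.subset subset_closure) r hr
  exact ⟨ht.toFinset, by simpa using hEt⟩

end CoveringNumbers

section Volume

variable {F : Type*} [NormedAddCommGroup F] [NormedSpace ℝ F] [FiniteDimensional ℝ F]

theorem card_le_pow_finrank_of_separated {r R : ℝ} (hr : 0 < r) (hrR : r ≤ R) (x : F)
    (t : Finset F) (ht : (t : Set F) ⊆ Metric.ball x R)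
    (hsep : ∀ y ∈ t, ∀ z ∈ t, y ≠ z → r ≤ dist y z) :
    (t.card : ℝ) ≤ (3 * (R / r)) ^ Module.finrank ℝ F := by
  borelize F
  let μ : Measure F := Measure.addHaar
  have hr2 : 0 < r / 2 := by positivity
  have hR2 : 0 < 3 * R / 2 := by linarith
  have hdisj : Set.Pairwise (t : Set F) (Function.onFun Disjoint fun c => Metric.ball c (r / 2)) := by
    intro y hy z hz hyz
    exact Metric.ball_disjoint_ball (by linarith [hsep y hy z hz hyz])
  have hsub : (⋃ c ∈ t, Metric.ball c (r / 2)) ⊆ Metric.ball x (3 * R / 2) := by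
    refine Set.iUnion₂_subset fun c hc => Metric.ball_subset_ball' ?_
    have := Metric.mem_ball.1 (ht hc)
    linarith
  have hvol : (t.card : ENNReal) * ENNReal.ofReal ((r / 2) ^ Module.finrank ℝ F) *
      μ (Metric.ball 0 1) ≤
      ENNReal.ofReal ((3 * R / 2) ^ Module.finrank ℝ F) * μ (Metric.ball 0 1) := by
    calc _ = μ (⋃ c ∈ t, Metric.ball c (r / 2)) := by
          rw [measure_biUnion_finset hdisj fun c _ => measurableSet_ball]
          simp only [μ.addHaar_ball_of_pos _ hr2, Finset.sum_const, nsmul_eq_mul, mul_assoc]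
      _ ≤ μ (Metric.ball x (3 * R / 2)) := measure_mono hsub
      _ = _ := μ.addHaar_ball_of_pos _ hR2
  have hvol' := (ENNReal.mul_le_mul_iff_left
    (measure_ball_pos μ (0 : F) zero_lt_one).ne' measure_ball_lt_top.ne).1 hvol
  have hreal := ENNReal.toReal_le_of_le_ofReal (pow_nonneg hR2.le _) hvol'
  rw [ENNReal.toReal_mul, ENNReal.toReal_natCast,
    ENNReal.toReal_ofReal (pow_nonneg hr2.le _), ← le_div_iff₀ (pow_pos hr2 _), ← div_pow] at hreal
  have hratio : 3 * (R / r) = 3 * R / 2 / (r / 2) := by field_simp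
  rwa [hratio]

theorem coveringNumber_inter_ball_le (E : Set F) {r R : ℝ} (hr : 0 < r) (hrR : r ≤ R) (x : F) :
    (coveringNumber (E ∩ Metric.ball x R) r : ℝ) ≤ (3 * (R / r)) ^ Module.finrank ℝ F := by
  have hnonneg : 0 ≤ (3 * (R / r)) ^ Module.finrank ℝ F := by
    have := hr.trans_le hrR
    positivity
  refine (Nat.le_floor_iff hnonneg).1 (coveringNumber_le_of_separated hr fun t ht hsep => ?_)
  exact (Nat.le_floor_iff hnonneg).2
    (card_le_pow_finrank_of_separated hr hrR x t (ht.trans Set.inter_subset_right) hsep)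

theorem quasiAssouadAux_nonneg {α : Type*} [PseudoMetricSpace α] (E : Set α) (θ : ℝ) :
    0 ≤ quasiAssouadAux E θ :=
  Real.sInf_nonneg fun _ ht => ht.1

theorem finrank_mem_quasiAssouad_exponents (E : Set F) (θ : ℝ) :
    (Module.finrank ℝ F : ℝ) ∈ {t : ℝ | 0 ≤ t ∧ ∃ C : ℝ, 0 < C ∧ ∀ x ∈ E, ∀ r R : ℝ,
      0 < r → r ≤ R ^ (1 / θ) → R ^ (1 / θ) ≤ R → R < 1 →
      (coveringNumber (E ∩ Metric.ball x R) r : ℝ) ≤ C * (R / r) ^ t} := by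
  refine ⟨Nat.cast_nonneg _, 3 ^ Module.finrank ℝ F, by positivity, ?_⟩
  intro x _ r R hr h1 h2 _
  rw [Real.rpow_natCast, ← mul_pow]
  exact coveringNumber_inter_ball_le E hr (h1.trans h2) x

theorem quasiAssouadAux_le_finrank (E : Set F) (θ : ℝ) :
    quasiAssouadAux E θ ≤ Module.finrank ℝ F :=
  csInf_le ⟨0, fun _ ht => ht.1⟩ (finrank_mem_quasiAssouad_exponents E θ)

theorem isBoundedUnder_quasiAssouadAux (E : Set F) (l : Filter ℝ) :
    l.IsBoundedUnder (· ≤ ·) (quasiAssouadAux E) :=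
  isBoundedUnder_of ⟨_, quasiAssouadAux_le_finrank E⟩

theorem dimqA_nonneg (E : Set F) : 0 ≤ dimqA E :=
  le_limsup_of_frequently_le (Frequently.of_forall (quasiAssouadAux_nonneg E))
    (isBoundedUnder_quasiAssouadAux E _)

theorem dimqA_le_finrank (E : Set F) : dimqA E ≤ Module.finrank ℝ F :=
  limsup_le_of_le
    (IsBoundedUnder.isCoboundedUnder_le (isBoundedUnder_of ⟨0, quasiAssouadAux_nonneg E⟩))
    (Eventually.of_forall (quasiAssouadAux_le_finrank E))

theorem monotone_log_coveringNumber {E : Set F} (hE : E.Nonempty)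
    (hEb : Bornology.IsBounded E) :
    Monotone fun u : ℝ => Real.log (coveringNumber E (Real.exp (-u))) := by
  intro u v huv
  have hcov := fun w : ℝ => exists_finset_cover_of_isBounded hEb (Real.exp_pos (-w))
  refine Real.log_le_log (by exact_mod_cast coveringNumber_pos hE (hcov u)) ?_
  exact_mod_cast coveringNumber_anti (Real.exp_le_exp.2 (neg_le_neg huv)) (hcov v)

/-- Covering numbers grow at most like the quasi-Assouad dimension between separated scales. -/
theorem exists_log_coveringNumber_le {E : Set F} (hE : E.Nonempty)
    (hEb : Bornology.IsBounded E) {ε : ℝ} (hε : 0 < ε) :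
    ∃ θ : ℝ, 1 - ε < θ ∧ 0 < θ ∧ θ < 1 ∧ ∃ C : ℝ, ∀ u v : ℝ, 1 ≤ u → u ≤ θ * v →
      Real.log (coveringNumber E (Real.exp (-v))) ≤
        Real.log (coveringNumber E (Real.exp (-u))) + C + (dimqA E + ε) * (v - u) := by
  have hev : ∀ᶠ θ in nhdsWithin (1 : ℝ) (Set.Iio 1), quasiAssouadAux E θ < dimqA E + ε :=
    eventually_lt_of_limsup_lt (lt_add_of_pos_right (dimqA E) hε)
      (isBoundedUnder_quasiAssouadAux E _)
  have hmax : max (1 - ε) 0 < (1 : ℝ) := max_lt (by linarith) zero_lt_one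
  obtain ⟨θ, hθ, hθ1, hθ2⟩ := (hev.and (Ioo_mem_nhdsLT hmax)).exists
  obtain ⟨hθε, hθ0⟩ := max_lt_iff.1 hθ1
  obtain ⟨t, ⟨ht0, C, hC, hbound⟩, ht⟩ :=
    exists_lt_of_csInf_lt ⟨_, finrank_mem_quasiAssouad_exponents E θ⟩ hθ
  refine ⟨θ, hθε, hθ0, hθ2, Real.log C + t * Real.log 2, fun u v hu huv => ?_⟩
  have hcov := fun w : ℝ => exists_finset_cover_of_isBounded hEb (Real.exp_pos (-w))
  have hpos : ∀ w : ℝ, (0 : ℝ) < coveringNumber E (Real.exp (-w)) := fun w => by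
    exact_mod_cast coveringNumber_pos hE (hcov w)
  have huv' : u ≤ v := by nlinarith
  have h2R1 : 2 * Real.exp (-u) < 1 := by
    have h1 : Real.exp (-u) * Real.exp u = 1 := by rw [← Real.exp_add]; simp
    have h2 : 2 < Real.exp u := by
      have := Real.exp_one_gt_d9
      have := Real.exp_le_exp.2 hu
      linarith
    nlinarith [Real.exp_pos (-u)]
  have h2R0 : 0 < 2 * Real.exp (-u) := by positivity
  have hθinv : 1 ≤ 1 / θ := by rw [le_div_iff₀ hθ0]; linarith
  have hrR : Real.exp (-v) ≤ (2 * Real.exp (-u)) ^ (1 / θ) := by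
    calc Real.exp (-v) ≤ Real.exp (-u * (1 / θ)) := by
          refine Real.exp_le_exp.2 ?_
          have : u / θ ≤ v := by rw [div_le_iff₀ hθ0]; linarith
          rw [mul_one_div, neg_div]
          linarith
      _ = Real.exp (-u) ^ (1 / θ) := Real.exp_mul _ _
      _ ≤ _ := Real.rpow_le_rpow (Real.exp_pos _).le (by linarith [Real.exp_pos (-u)])
          (by positivity)
  have hRR : (2 * Real.exp (-u)) ^ (1 / θ) ≤ 2 * Real.exp (-u) :=
    Real.rpow_le_self_of_le_one h2R0.le h2R1.le hθinv
  have hratio : 0 < 2 * Real.exp (-u) / Real.exp (-v) := by positivity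
  have hmul := coveringNumber_le_mul (B := C * (2 * Real.exp (-u) / Real.exp (-v)) ^ t)
    (by positivity) (hcov v) (hcov u)
    (fun x hx => hbound x hx _ _ (Real.exp_pos _) hrR hRR h2R1)
  have hlog := Real.log_le_log (hpos v) hmul
  have hpw := Real.rpow_pos_of_pos hratio t
  rw [Real.log_mul (hpos u).ne' (mul_pos hC hpw).ne', Real.log_mul hC.ne' hpw.ne',
    Real.log_rpow hratio, Real.log_div h2R0.ne' (Real.exp_pos _).ne',
    Real.log_mul two_ne_zero (Real.exp_pos _).ne', Real.log_exp, Real.log_exp] at hlog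
  nlinarith [mul_le_mul_of_nonneg_right ht.le (sub_nonneg.2 huv')]

end Volume

section Regularization

/-- The largest nondecreasing `a`-Lipschitz minorant of a nondecreasing function `φ`. -/
def lipschitzMinorant (a : ℝ) (φ : ℝ → ℝ) (v : ℝ) : ℝ :=
  ⨅ u : ℝ, (φ u + a * max (v - u) 0)

variable {a : ℝ} {φ : ℝ → ℝ}

theorem lipschitzMinorant_le (ha : 0 ≤ a) (hφ : ∀ u, 0 ≤ φ u) (u v : ℝ) :
    lipschitzMinorant a φ v ≤ φ u + a * max (v - u) 0 :=
  ciInf_le (f := fun u : ℝ => φ u + a * max (v - u) 0) ⟨0, by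
    rintro _ ⟨u, rfl⟩
    exact add_nonneg (hφ u) (mul_nonneg ha (le_max_right _ _))⟩ u

theorem lipschitzMinorant_nonneg (ha : 0 ≤ a) (hφ : ∀ u, 0 ≤ φ u) (v : ℝ) :
    0 ≤ lipschitzMinorant a φ v :=
  le_ciInf fun u => add_nonneg (hφ u) (mul_nonneg ha (le_max_right _ _))

theorem lipschitzMinorant_mono (ha : 0 ≤ a) (hφ : ∀ u, 0 ≤ φ u) :
    Monotone (lipschitzMinorant a φ) := fun v w hvw =>
  le_ciInf fun u => (lipschitzMinorant_le ha hφ u v).trans (by gcongr)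

theorem lipschitzMinorant_le_add (ha : 0 ≤ a) (hφ : ∀ u, 0 ≤ φ u) {v w : ℝ} (hvw : v ≤ w) :
    lipschitzMinorant a φ w ≤ lipschitzMinorant a φ v + a * (w - v) := by
  rw [← sub_le_iff_le_add]
  refine le_ciInf fun u => ?_
  have h1 := lipschitzMinorant_le ha hφ u w
  have h2 : max (w - u) 0 ≤ max (v - u) 0 + (w - v) :=
    max_le (by linarith [le_max_left (v - u) 0]) (by linarith [le_max_right (v - u) 0])
  nlinarith

theorem continuous_lipschitzMinorant (ha : 0 ≤ a) (hφ : ∀ u, 0 ≤ φ u) :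
    Continuous (lipschitzMinorant a φ) := by
  refine (LipschitzWith.of_le_add_mul ⟨a, ha⟩ fun v w => ?_).continuous
  change _ ≤ _ + a * dist v w
  rcases le_total v w with h | h
  · exact (lipschitzMinorant_mono ha hφ h).trans
      (le_add_of_nonneg_right (mul_nonneg ha dist_nonneg))
  · rw [Real.dist_eq, abs_of_nonneg (sub_nonneg.2 h)]
    exact lipschitzMinorant_le_add ha hφ h

theorem upperDini_mem_Icc {g : ℝ → ℝ} {x b c : ℝ}
    (h : ∀ e : ℝ, 0 < e → (g (x + e) - g x) / e ∈ Set.Icc b c) :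
    upperDini g x ∈ Set.Icc b c := by
  have hev : ∀ᶠ e in nhdsWithin (0 : ℝ) (Set.Ioi 0), (g (x + e) - g x) / e ∈ Set.Icc b c :=
    eventually_nhdsWithin_of_forall h
  have hub := hev.mono fun _ he => he.2
  have hlb := hev.mono fun _ he => he.1
  exact ⟨le_limsup_of_frequently_le hlb.frequently ⟨c, eventually_map.2 hub⟩,
    limsup_le_of_le (IsBoundedUnder.isCoboundedUnder_le ⟨b, eventually_map.2 hlb⟩) hub⟩

/-- Nondecreasing `a`-Lipschitz functions vanishing at zero correspond to elements of `𝒢(0, a)`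
through the change of variables `u = exp x`. -/
theorem div_exp_mem_GClass {G : ℝ → ℝ} (hcont : Continuous G) (hmono : Monotone G)
    (h0 : G 0 = 0) (hlip : ∀ v w, v ≤ w → G w ≤ G v + a * (w - v)) :
    (fun x => G (Real.exp x) / Real.exp x) ∈ GClass 0 a := by
  refine ⟨(hcont.comp Real.continuous_exp).div Real.continuous_exp fun x => (Real.exp_pos x).ne',
    fun x => ⟨?_, ?_⟩, fun x => upperDini_mem_Icc fun e he => ?_⟩
  · exact div_nonneg (h0 ▸ hmono (Real.exp_pos x).le) (Real.exp_pos x).le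
  · rw [div_le_iff₀ (Real.exp_pos x)]
    simpa [h0] using hlip 0 (Real.exp x) (Real.exp_pos x).le
  · have hx := Real.exp_pos x
    have hGx : 0 ≤ G (Real.exp x) := h0 ▸ hmono hx.le
    have hGa : G (Real.exp x) ≤ a * Real.exp x := by
      simpa [h0] using hlip 0 (Real.exp x) hx.le
    have hle : Real.exp x ≤ Real.exp (x + e) := Real.exp_le_exp.2 (by linarith)
    have h1 := hmono hle
    have h2 := hlip _ _ hle
    have hexp : Real.exp x = Real.exp (x + e) * Real.exp (-e) := by
      rw [← Real.exp_add]; ring_nf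
    have hq : 1 - e ≤ Real.exp (-e) := by linarith [Real.add_one_le_exp (-e)]
    have hdecomp : ∀ y : ℝ, y / Real.exp (x + e) = y / Real.exp x * Real.exp (-e) := by
      intro y
      rw [hexp]
      field_simp
    set q := Real.exp (-e)
    set p := G (Real.exp x) / Real.exp x with hp
    have hp0 : 0 ≤ p := div_nonneg hGx hx.le
    have hpa : p ≤ a := by rw [hp, div_le_iff₀ hx]; exact hGa
    have hlow : p * q ≤ G (Real.exp (x + e)) / Real.exp (x + e) := by
      rw [hp, ← hdecomp]
      gcongr
    have hupp : G (Real.exp (x + e)) / Real.exp (x + e) ≤ p * q + a * (1 - q) := by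
      have hsplit : (G (Real.exp x) + a * (Real.exp (x + e) - Real.exp x)) / Real.exp (x + e) =
          p * q + a * (1 - q) := by
        rw [hp, ← hdecomp]
        have : Real.exp (x + e) ≠ 0 := (Real.exp_pos _).ne'
        field_simp
        rw [hexp]
        ring
      rw [← hsplit]
      gcongr
    constructor
    · rw [le_div_iff₀ he]
      nlinarith
    · rw [div_le_iff₀ he]
      nlinarith [mul_nonneg (sub_nonneg.2 hpa) (sub_nonneg.2 hq)]

theorem GClass_mono_right {b c d : ℝ} (h : c ≤ d) : GClass b c ⊆ GClass b d :=
  fun _ ⟨hc, hg, hD⟩ => ⟨hc, fun x => ⟨(hg x).1, (hg x).2.trans h⟩,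
    fun x => ⟨(hD x).1, (hD x).2.trans (by linarith)⟩⟩

theorem lipschitzMinorant_zero (ha : 0 ≤ a) (hφ : ∀ u, 0 ≤ φ u) (h0 : φ 0 = 0) :
    lipschitzMinorant a φ 0 = 0 :=
  le_antisymm (by simpa [h0] using lipschitzMinorant_le ha hφ 0 0)
    (lipschitzMinorant_nonneg ha hφ 0)

theorem sub_lipschitzMinorant_le (ha : 0 ≤ a) (hφ : ∀ u, 0 ≤ φ u) (hmono : Monotone φ)
    {ε θ C : ℝ} (hε : 0 ≤ ε) (hθε : 1 - ε < θ) (hθ0 : 0 < θ) (hθ1 : θ < 1)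
    (hgrowth : ∀ u v : ℝ, 1 ≤ u → u ≤ θ * v → φ v ≤ φ u + C + (a + ε) * (v - u))
    {v : ℝ} (hv : 1 ≤ θ * v) :
    φ v - lipschitzMinorant a φ v ≤ φ 1 + |C| + (ε + (a + ε) * ε) * v := by
  have hv1 : 1 ≤ v := by nlinarith
  have hC := le_abs_self C
  have hC0 := abs_nonneg C
  have h1 := hφ 1
  have hsq : 0 ≤ (a + ε) * ε * v := by positivity
  rw [sub_le_comm]
  refine le_ciInf fun u => ?_
  have hm := mul_le_mul_of_nonneg_left (le_max_left (v - u) 0) ha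
  have hm0 := mul_nonneg ha (le_max_right (v - u) 0)
  have hu := hφ u
  rcases lt_or_ge u 1 with hu1 | hu1
  · have := hgrowth 1 v le_rfl hv
    nlinarith
  rcases le_or_gt u (θ * v) with huv | huv
  · have := hgrowth u v hu1 huv
    nlinarith
  · have h3 := hgrowth (θ * v) v hv le_rfl
    have h4 := hmono huv.le
    have h5 : (a + ε) * (v - θ * v) ≤ (a + ε) * (ε * v) := by
      refine mul_le_mul_of_nonneg_left ?_ (by positivity)
      nlinarith
    nlinarith

theorem tendsto_div_sub_lipschitzMinorant_div (ha : 0 ≤ a) (hφ : ∀ u, 0 ≤ φ u)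
    (hmono : Monotone φ)
    (hgrowth : ∀ ε : ℝ, 0 < ε → ∃ θ : ℝ, 1 - ε < θ ∧ 0 < θ ∧ θ < 1 ∧ ∃ C : ℝ,
      ∀ u v : ℝ, 1 ≤ u → u ≤ θ * v → φ v ≤ φ u + C + (a + ε) * (v - u)) :
    Tendsto (fun v => φ v / v - lipschitzMinorant a φ v / v) atTop (nhds 0) := by
  rw [Metric.tendsto_nhds]
  intro δ hδ
  set ε := min 1 (δ / (2 * (a + 2)))
  have hε : 0 < ε := lt_min one_pos (by positivity)
  have hε1 : ε ≤ 1 := min_le_left _ _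
  have hεδ : ε * (2 * (a + 2)) ≤ δ := by
    rw [← le_div_iff₀ (by positivity)]
    exact min_le_right _ _
  have hsmall : ε + (a + ε) * ε ≤ δ / 2 := by nlinarith
  obtain ⟨θ, hθε, hθ0, hθ1, C, hC⟩ := hgrowth ε hε
  filter_upwards [eventually_ge_atTop (1 / θ), eventually_gt_atTop 0,
    eventually_gt_atTop (2 * (φ 1 + |C|) / δ)] with v hv hv0 hvK
  rw [div_le_iff₀' hθ0] at hv
  rw [div_lt_iff₀ hδ] at hvK
  have hle := sub_lipschitzMinorant_le ha hφ hmono hε.le hθε hθ0 hθ1 hC hv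
  have hge : lipschitzMinorant a φ v ≤ φ v := by simpa using lipschitzMinorant_le ha hφ v v
  rw [Real.dist_eq, sub_zero, ← sub_div, abs_of_nonneg (div_nonneg (sub_nonneg.2 hge) hv0.le),
    div_lt_iff₀ hv0]
  nlinarith

end Regularization

/-- For any non-empty bounded `E ⊆ ℝ^d`, the function
`x ↦ s_E(exp(-exp x))` is asymptotically equivalent to some `g ∈ 𝒢(0, dim_qA E) ⊆ 𝒢(0, d)`. -/
theorem covering_class_exists {d : ℕ} (hd : 1 ≤ d) (E : Set (EuclideanSpace ℝ (Fin d)))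
    (hE : E.Nonempty) (hEb : Bornology.IsBounded E) :
    ∃ g : ℝ → ℝ, g ∈ GClass 0 (dimqA E) ∧ g ∈ GClass 0 d ∧
      AsympEquiv (fun x => sFun E (Real.exp (-Real.exp x))) g := by
  set φ : ℝ → ℝ := fun u =>
    if u ≤ 0 then 0 else Real.log (coveringNumber E (Real.exp (-u))) with hφdef
  have hmonoN := monotone_log_coveringNumber hE hEb
  have hφ_of_pos : ∀ u, 0 < u → φ u = Real.log (coveringNumber E (Real.exp (-u))) :=
    fun u hu => if_neg hu.not_ge
  have hφ : ∀ u, 0 ≤ φ u := fun u => by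
    simp only [hφdef]
    split_ifs
    exacts [le_rfl, Real.log_natCast_nonneg _]
  have hφ0 : φ 0 = 0 := if_pos le_rfl
  have hmono : Monotone φ := fun u v huv => by
    rcases le_or_gt u 0 with hu | hu
    · rw [show φ u = 0 from if_pos hu]
      exact hφ v
    · rw [hφ_of_pos u hu, hφ_of_pos v (hu.trans_le huv)]
      exact hmonoN huv
  have ha := dimqA_nonneg E
  have hgrowth : ∀ ε : ℝ, 0 < ε → ∃ θ : ℝ, 1 - ε < θ ∧ 0 < θ ∧ θ < 1 ∧ ∃ C : ℝ,
      ∀ u v : ℝ, 1 ≤ u → u ≤ θ * v → φ v ≤ φ u + C + (dimqA E + ε) * (v - u) := by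
    intro ε hε
    obtain ⟨θ, h1, h2, h3, C, hC⟩ := exists_log_coveringNumber_le hE hEb hε
    refine ⟨θ, h1, h2, h3, C, fun u v hu huv => ?_⟩
    have hv : 0 < v := pos_of_mul_pos_right (by linarith : 0 < θ * v) h2.le
    rw [hφ_of_pos u (by linarith), hφ_of_pos v hv]
    exact hC u v hu huv
  have hmem := div_exp_mem_GClass (continuous_lipschitzMinorant ha hφ)
    (lipschitzMinorant_mono ha hφ) (lipschitzMinorant_zero ha hφ hφ0)
    (fun v w hvw => lipschitzMinorant_le_add ha hφ hvw)
  refine ⟨_, hmem, GClass_mono_right (by simpa using dimqA_le_finrank E) hmem, ?_⟩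
  refine ((tendsto_div_sub_lipschitzMinorant_div ha hφ hmono hgrowth).comp
    Real.tendsto_exp_atTop).congr fun x => ?_
  simp only [Function.comp_apply, hφ_of_pos _ (Real.exp_pos x), sFun, one_div,
    Real.log_inv, Real.log_exp, neg_neg]

end
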